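/- For every natural number n ≥ 9, there exists an injective map P : ZMod n → ℝ² such that: (i) for every j ∈ ZMod n, the three points P j, P (j+1), P (j+3) are collinear; and (ii) for every j ∈ ZMod n and every k ∈ ZMod n with k ∉ {j, j+1, j+3}, the four points P j, P (j+1), P (j+3), P k are not collinear. In other words, the combinatorial configuration 𝒞(n, 1, 3) admits a geometric realization by points and straight lines in the Euclidean plane in which each of the n lines contains exactly the 3 prescribed points; hence geometric (n₃) configurations exist for every n ≥ 9. -/

import Mathlib

section Geometry

open Real

/-- The determinant of the matrix with rows `p`, `q`, `r`. -/
def tripleDet {R : Type*} [CommRing R] (p q r : Fin 3 → R) : R :=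
  p 0 * (q 1 * r 2 - q 2 * r 1) - p 1 * (q 0 * r 2 - q 2 * r 0) + p 2 * (q 0 * r 1 - q 1 * r 0)

theorem collinear_triple_iff (a b c : EuclideanSpace ℝ (Fin 2)) :
    Collinear ℝ {a, b, c} ↔ (b 0 - a 0) * (c 1 - a 1) = (b 1 - a 1) * (c 0 - a 0) := by
  rw [collinear_iff_of_mem (p₀ := a) (by simp)]
  constructor
  · rintro ⟨v, hv⟩
    obtain ⟨r, rfl⟩ := hv b (by simp)
    obtain ⟨s, rfl⟩ := hv c (by simp)
    simp
    ring
  · intro h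
    by_cases hb : b = a
    · subst hb
      refine ⟨c - b, ?_⟩
      rintro p (rfl | rfl | rfl)
      · exact ⟨0, by simp⟩
      · exact ⟨0, by simp⟩
      · exact ⟨1, by simp⟩
    · refine ⟨b - a, ?_⟩
      rintro p (rfl | rfl | rfl)
      · exact ⟨0, by simp⟩
      · exact ⟨1, by simp⟩
      · have hne : b 0 - a 0 ≠ 0 ∨ b 1 - a 1 ≠ 0 := by
          by_contra! hcon
          refine hb (PiLp.ext fun i => ?_)
          fin_cases i
          · exact sub_eq_zero.1 hcon.1
          · exact sub_eq_zero.1 hcon.2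
        rcases hne with h0 | h1
        · refine ⟨(p 0 - a 0) / (b 0 - a 0), PiLp.ext fun i => ?_⟩
          fin_cases i
          · simp [h0]
          · simp
            field_simp
            linear_combination h
        · refine ⟨(p 1 - a 1) / (b 1 - a 1), PiLp.ext fun i => ?_⟩
          fin_cases i
          · simp
            field_simp
            linear_combination -h
          · simp [h1]

/-- The affine point with homogeneous coordinates `p`. -/
noncomputable def affinePoint (p : Fin 3 → ℝ) : EuclideanSpace ℝ (Fin 2) :=
  !₂[p 0 / p 2, p 1 / p 2]

theorem collinear_affinePoint_iff {p q r : Fin 3 → ℝ} (hp : p 2 ≠ 0) (hq : q 2 ≠ 0)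
    (hr : r 2 ≠ 0) :
    Collinear ℝ {affinePoint p, affinePoint q, affinePoint r} ↔ tripleDet p q r = 0 := by
  have h : tripleDet p q r = p 2 * q 2 * r 2 *
      ((q 0 / q 2 - p 0 / p 2) * (r 1 / r 2 - p 1 / p 2) -
        (q 1 / q 2 - p 1 / p 2) * (r 0 / r 2 - p 0 / p 2)) := by
    unfold tripleDet
    field_simp
    ring
  rw [collinear_triple_iff, h]
  simp [affinePoint, hp, hq, hr, sub_eq_zero]

/-- A realization of `𝒞(n,1,3)` from homogeneous coordinates. -/
theorem exists_realization_of_tripleDet {n : ℕ} (hn : 9 ≤ n) (p : ZMod n → Fin 3 → ℝ)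
    (hp : ∀ j, p j 2 ≠ 0)
    (hdet : ∀ j k, tripleDet (p j) (p (j + 1)) (p k) = 0 ↔ k = j ∨ k = j + 1 ∨ k = j + 3) :
    ∃ P : ZMod n → EuclideanSpace ℝ (Fin 2),
      Function.Injective P ∧
      (∀ j : ZMod n, Collinear ℝ ({P j, P (j + 1), P (j + 3)} : Set (EuclideanSpace ℝ (Fin 2)))) ∧
      (∀ j k : ZMod n, k ∉ ({j, j + 1, j + 3} : Set (ZMod n)) →
        ¬ Collinear ℝ
          ({P j, P (j + 1), P (j + 3), P k} : Set (EuclideanSpace ℝ (Fin 2)))) := by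
  have hcol (j k : ZMod n) :
      Collinear ℝ {affinePoint (p j), affinePoint (p (j + 1)), affinePoint (p k)} ↔
        k = j ∨ k = j + 1 ∨ k = j + 3 := by
    rw [collinear_affinePoint_iff (hp _) (hp _) (hp _), hdet]
  have hcast (a : ℕ) (ha : 0 < a) (han : a < n) : (a : ZMod n) ≠ 0 := by
    rw [Ne, ZMod.natCast_eq_zero_iff]
    exact Nat.not_dvd_of_pos_of_lt ha han
  have hmem (i j : ZMod n) (h : affinePoint (p i) = affinePoint (p j)) :
      j = i ∨ j = i + 1 ∨ j = i + 3 := by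
    rw [← hcol, ← h, Set.pair_comm (affinePoint (p (i + 1))), Set.insert_comm, Set.insert_comm]
    simpa using collinear_pair ℝ _ _
  refine ⟨fun j => affinePoint (p j), fun i j h => ?_, fun j => (hcol j _).2 (by simp),
    fun j k hk hc => hk ?_⟩
  · have h2 := hcast 2 (by lia) (by lia)
    have h4 := hcast 4 (by lia) (by lia)
    have h6 := hcast 6 (by lia) (by lia)
    push_cast at h2 h4 h6
    rcases hmem i j h with h1 | h1 | h1 <;> rcases hmem j i h.symm with h3 | h3 | h3 <;> grind
  · have := (hcol j k).1 (hc.subset (by intro; simp; tauto))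
    simpa using this

theorem tripleDet_sin (a b c φ : ℝ) :
    tripleDet ![sin (a - φ), sin (3 * a), cos (a - φ)] ![sin (b - φ), sin (3 * b), cos (b - φ)]
      ![sin (c - φ), sin (3 * c), cos (c - φ)] =
      -4 * (sin (a - b) * sin (b - c) * sin (c - a) * sin (a + b + c)) := by
  have hφ := sin_sq_add_cos_sq φ
  have ha := sin_sq_add_cos_sq a
  have hb := sin_sq_add_cos_sq b
  have hc := sin_sq_add_cos_sq c
  have h3 (x : ℝ) : sin (3 * x) = 3 * sin x * cos x ^ 2 - sin x ^ 3 := by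
    rw [sin_three_mul]
    linear_combination (-3 * sin x) * sin_sq_add_cos_sq x
  have hdet : tripleDet ![sin (a - φ), sin (3 * a), cos (a - φ)]
      ![sin (b - φ), sin (3 * b), cos (b - φ)] ![sin (c - φ), sin (3 * c), cos (c - φ)] =
      (sin (3 * a) * sin (c - b) * (sin b ^ 2 + cos b ^ 2) * (sin c ^ 2 + cos c ^ 2) +
      sin (3 * b) * sin (a - c) * (sin a ^ 2 + cos a ^ 2) * (sin c ^ 2 + cos c ^ 2) +
      sin (3 * c) * sin (b - a) * (sin a ^ 2 + cos a ^ 2) * (sin b ^ 2 + cos b ^ 2)) *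
      (sin φ ^ 2 + cos φ ^ 2) := by
    rw [ha, hb, hc]
    simp only [tripleDet, sin_sub, cos_sub, Matrix.cons_val]
    ring
  rw [hdet, hφ]
  simp only [h3, sin_sub, sin_add, cos_add]
  ring

theorem sin_pi_mul_eq_zero_iff (t : ℝ) : sin (π * t) = 0 ↔ (t : UnitAddCircle) = 0 := by
  rw [sin_eq_zero_iff, AddCircle.coe_eq_zero_iff]
  refine exists_congr fun k => ?_
  rw [mul_comm π, mul_left_inj' pi_ne_zero]
  simp

theorem exists_forall_cos_sub_ne_zero {ι : Type*} [Countable ι] (θ : ι → ℝ) :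
    ∃ φ, ∀ i, cos (θ i - φ) ≠ 0 := by
  by_contra! h
  refine Set.not_countable_univ (α := ℝ) ((Set.countable_range
    fun q : ι × ℤ => θ q.1 - (2 * q.2 + 1) * π / 2).mono fun φ _ => ?_)
  obtain ⟨i, hi⟩ := h φ
  obtain ⟨k, hk⟩ := cos_eq_zero_iff.1 hi
  exact ⟨(i, k), by simp only [← hk]; ring⟩

/-- A realization of `𝒞(n,1,3)` on the cubic parametrized by `θ ↦ (cos θ : sin θ : sin (3 * θ))`, from a
labelling in the circle group. -/
theorem exists_realization_of_unitAddCircle {n : ℕ} (hn : 9 ≤ n) (x : ZMod n → UnitAddCircle)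
    (hx : Function.Injective x) (hsum : ∀ j, x j + x (j + 1) + x (j + 3) = 0) :
    ∃ P : ZMod n → EuclideanSpace ℝ (Fin 2),
      Function.Injective P ∧
      (∀ j : ZMod n, Collinear ℝ ({P j, P (j + 1), P (j + 3)} : Set (EuclideanSpace ℝ (Fin 2)))) ∧
      (∀ j k : ZMod n, k ∉ ({j, j + 1, j + 3} : Set (ZMod n)) →
        ¬ Collinear ℝ
          ({P j, P (j + 1), P (j + 3), P k} : Set (EuclideanSpace ℝ (Fin 2)))) := by
  have : NeZero n := ⟨by lia⟩
  have : Fact (1 < n) := ⟨by lia⟩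
  choose t ht using fun j => QuotientAddGroup.mk_surjective (x j)
  replace ht (j) : (t j : UnitAddCircle) = x j := ht j
  obtain ⟨φ, hφ⟩ := exists_forall_cos_sub_ne_zero fun j => π * t j
  refine exists_realization_of_tripleDet hn
    (fun j => ![sin (π * t j - φ), sin (3 * (π * t j)), cos (π * t j - φ)])
    (fun j => by simpa using hφ j) fun j k => ?_
  rw [tripleDet_sin]
  simp only [← mul_sub, ← mul_add, mul_eq_zero, sin_pi_mul_eq_zero_iff, AddCircle.coe_sub,
    AddCircle.coe_add, ht, sub_eq_zero, hx.eq_iff]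
  have h3 : x j + x (j + 1) + x k = 0 ↔ k = j + 3 := by
    rw [← hsum j, add_right_inj, hx.eq_iff]
  rw [h3]
  simp [eq_comm, or_assoc, or_left_comm]

end Geometry

/-- The companion matrix of the recurrence `x (j + 3) = -x j - x (j + 1)`. -/
def recurrenceMatrix : Matrix (Fin 3) (Fin 3) ℤ := !![0, 1, 0; 0, 0, 1; -1, -1, 0]

theorem recurrenceMatrix_pow_add (t : ℕ) :
    recurrenceMatrix ^ t + recurrenceMatrix ^ (t + 1) + recurrenceMatrix ^ (t + 3) = 0 := by
  have h : 1 + recurrenceMatrix + recurrenceMatrix ^ 3 = 0 := by decide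
  rw [pow_succ, pow_add _ t 3]
  nth_rw 1 [← mul_one (recurrenceMatrix ^ t)]
  rw [← mul_add, ← mul_add, h, mul_zero]

theorem recurrenceMatrix_pow_mul_apply (M : Matrix (Fin 3) (Fin 3) ℤ) (s c : Fin 3) :
    (recurrenceMatrix ^ (s : ℕ) * M) 0 c = M s c := by
  fin_cases s <;>
    simp [recurrenceMatrix, pow_two, Matrix.mul_apply, Fin.sum_univ_three]

theorem natAbs_det_le_of_forall_nsmul_eq_zero {n k m D : ℕ} (hn : n ≠ 0)
    (hD : D = (recurrenceMatrix ^ n - 1).det.natAbs) (hD0 : D ≠ 0) (hm : m ≠ 0)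
    (hk : (recurrenceMatrix ^ k - 1).det ≠ 0)
    (h : ∀ x : ZMod n → ZMod D, (∀ j, x j + x (j + 1) + x (j + 3) = 0) →
      ∀ i, m • (x (i + k) - x i) = 0) :
    D ≤ m ^ 3 * (recurrenceMatrix ^ k - 1).det.natAbs := by
  have : NeZero n := ⟨hn⟩
  set A := recurrenceMatrix with hA
  set B := A ^ n - 1 with hB
  set M : Matrix (Fin 3) (Fin 3) ℤ := m • ((A ^ k - 1) * B.adjugate) with hM
  have hdvd (s c : Fin 3) : (D : ℤ) ∣ M s c := by
    set z : ℕ → ZMod D := fun t => ((A ^ t * B.adjugate) 0 c : ℤ) with hz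
    have hper : Function.Periodic z n := fun t => by
      have h1 : A ^ (t + n) * B.adjugate = B.det • A ^ t + A ^ t * B.adjugate := by
        rw [pow_add, ← sub_add_cancel (A ^ n) 1, ← hB, mul_assoc, add_mul, Matrix.mul_adjugate,
          one_mul, mul_add, mul_smul_comm, mul_one]
      have h2 : (B.det : ZMod D) = 0 := by
        rw [ZMod.intCast_zmod_eq_zero_iff_dvd, hD]
        exact Int.natAbs_dvd.2 dvd_rfl
      simp only [hz, h1, Matrix.add_apply, Matrix.smul_apply, smul_eq_mul, Int.cast_add,
        Int.cast_mul, h2, zero_mul, zero_add]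
    have hval (t : ℕ) : z (t : ZMod n).val = z t := by
      rw [ZMod.val_natCast, hper.map_mod_nat]
    have hrec (j : ZMod n) : z j.val + z (j + 1).val + z (j + 3).val = 0 := by
      obtain ⟨t, rfl⟩ := ZMod.natCast_zmod_surjective j
      have h1 := hval (t + 1)
      have h3 := hval (t + 3)
      push_cast at h1 h3
      rw [hval, h1, h3]
      simp only [hz]
      rw [← Int.cast_add, ← Int.cast_add, ← Matrix.add_apply, ← Matrix.add_apply, ← add_mul,
        ← add_mul, recurrenceMatrix_pow_add]
      simp
    have hs := h (fun j => z j.val) hrec (s : ℕ)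
    have hsk := hval (s + k)
    push_cast at hsk
    simp only [hsk, hval] at hs
    rw [← recurrenceMatrix_pow_mul_apply M, ← ZMod.intCast_zmod_eq_zero_iff_dvd, ← hs]
    simp only [hz, ← hA, hM]
    rw [← Int.cast_sub, ← Matrix.sub_apply, ← sub_mul, pow_add, mul_smul_comm, ← mul_assoc,
      mul_sub, mul_one, Matrix.smul_apply]
    simp
  choose C hC using hdvd
  have hmat : M * B = ((D : ℤ) • Matrix.of C) * B := by
    congr 1
    ext s c
    simp [hC]
  have hdet := congrArg (fun M => M.det.natAbs) hmat
  simp only [hM, smul_mul_assoc, mul_assoc, Matrix.adjugate_mul] at hdet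
  rw [mul_smul_comm, mul_one, ← natCast_zsmul, Matrix.det_smul, Matrix.det_smul, Matrix.det_smul,
    Matrix.det_mul] at hdet
  simp only [Int.natAbs_mul, Int.natAbs_pow, ← hD, Fintype.card_fin, Int.natAbs_natCast] at hdet
  have key : m ^ 3 * (A ^ k - 1).det.natAbs = (Matrix.of C).det.natAbs * D := by
    apply Nat.eq_of_mul_eq_mul_left (pow_pos (Nat.pos_of_ne_zero hD0) 3)
    linarith
  rw [key]
  refine Nat.le_mul_of_pos_left _ (Nat.pos_of_ne_zero fun h0 => ?_)
  rw [h0, zero_mul] at key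
  simp_all

open scoped Pointwise in
/-- If the labellings of `𝒞(n,1,3)` by `ZMod D` take enough values, one of them is injective. -/
theorem exists_injective_of_lt {n D : ℕ} (hn : n ≠ 0)
    (hD : D = (recurrenceMatrix ^ n - 1).det.natAbs)
    (hlt : ∀ k, 1 ≤ k → k ≤ n / 2 → (recurrenceMatrix ^ k - 1).det ≠ 0 ∧
      (n * (n / 2)) ^ 3 * (recurrenceMatrix ^ k - 1).det.natAbs < D) :
    ∃ x : ZMod n → ZMod D, Function.Injective x ∧ ∀ j, x j + x (j + 1) + x (j + 3) = 0 := by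
  have : NeZero n := ⟨hn⟩
  let G : AddSubgroup (ZMod n → ZMod D) :=
    { carrier := {x | ∀ j, x j + x (j + 1) + x (j + 3) = 0}
      zero_mem' := by simp
      add_mem' := fun {x y} hx hy j => by
        simp only [Set.mem_ofPred_eq, Pi.add_apply] at *
        linear_combination hx j + hy j
      neg_mem' := fun {x} hx j => by
        simp only [Set.mem_ofPred_eq, Pi.neg_apply] at *
        linear_combination -hx j }
  let H : ZMod n × ℕ → AddSubgroup G := fun q =>
    ((Pi.evalAddMonoidHom (fun _ : ZMod n => ZMod D) (q.1 + (q.2 : ZMod n)) -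
      Pi.evalAddMonoidHom (fun _ : ZMod n => ZMod D) q.1).comp
      G.subtype).ker
  have hH (q : ZMod n × ℕ) (x : G) : x ∈ H q ↔ x.1 (q.1 + (q.2 : ZMod n)) - x.1 q.1 = 0 := Iff.rfl
  by_contra! hcon
  have hcover : ⋃ q ∈ (Finset.univ : Finset (ZMod n)) ×ˢ Finset.Icc 1 (n / 2),
      (0 : G) +ᵥ (H q : Set G) = Set.univ := by
    refine Set.eq_univ_of_forall fun x => ?_
    have hx : ¬ Function.Injective x.1 := fun hinj => (hcon x.1 hinj).elim fun j hj => hj (x.2 j)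
    simp only [Function.Injective, not_forall] at hx
    obtain ⟨i, j, hij, hne⟩ := hx
    simp only [zero_vadd, Set.mem_iUnion, SetLike.mem_coe, hH, Finset.mem_product,
      Finset.mem_univ, true_and, Finset.mem_Icc]
    have hpos : (j - i).val ≠ 0 := by
      rw [Ne, ZMod.val_eq_zero, sub_eq_zero]
      exact fun h => hne h.symm
    have hneg : (i - j).val = n - (j - i).val := by
      have : NeZero (j - i) := ⟨by rwa [Ne, ← ZMod.val_eq_zero]⟩
      rw [← neg_sub j i, ZMod.val_neg_of_ne_zero]
    have hlt := ZMod.val_lt (j - i)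
    by_cases hle : (j - i).val ≤ n / 2
    · exact ⟨(i, (j - i).val), ⟨by lia, hle⟩, by simp [hij]⟩
    · exact ⟨(j, (i - j).val), ⟨by lia, by lia⟩, by simp [hij]⟩
  obtain ⟨⟨i, k⟩, hq, hfin, hcard⟩ := AddSubgroup.exists_index_le_card_of_leftCoset_cover hcover
  simp only [Finset.mem_product, Finset.mem_univ, true_and, Finset.mem_Icc] at hq
  simp only [Finset.card_product, Finset.card_univ, ZMod.card, Nat.card_Icc,
    Nat.add_sub_cancel] at hcard
  obtain ⟨hk, hkD⟩ := hlt k hq.1 hq.2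
  have hle := natAbs_det_le_of_forall_nsmul_eq_zero hn hD (by lia) hfin.index_ne_zero hk
    fun x hx i' => by
      have hmem : (fun j => x (j + (i' - i))) ∈ G := fun j => by
        have := hx (j + (i' - i))
        rw [← this]
        ring_nf
      have := (hH _ _).1 ((H (i, k)).nsmul_index_mem ⟨_, hmem⟩)
      simp only [AddSubgroup.coe_nsmul, Pi.smul_apply] at this
      rw [smul_sub, ← this]
      ring_nf
  have : (H (i, k)).index ^ 3 ≤ (n * (n / 2)) ^ 3 := Nat.pow_le_pow_left hcard 3
  exact (hle.trans (Nat.mul_le_mul_right _ this)).not_gt hkD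

theorem det_recurrenceMatrix_pow_sub_one {v : Fin 3 → ℂ} (hv : Function.Injective v)
    (hroot : ∀ i, v i ^ 3 + v i + 1 = 0) (n : ℕ) :
    ((recurrenceMatrix ^ n - 1).det : ℂ) = ∏ i, (v i ^ n - 1) := by
  set A : Matrix (Fin 3) (Fin 3) ℂ := recurrenceMatrix.map (Int.castRingHom ℂ) with hA
  set V : Matrix (Fin 3) (Fin 3) ℂ := (Matrix.vandermonde v).transpose with hV
  have hAV : A * V = V * Matrix.diagonal v := by
    ext i j
    rw [Matrix.mul_diagonal]
    fin_cases i <;>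
      simp [hA, hV, recurrenceMatrix, Matrix.mul_apply, Fin.sum_univ_three, Matrix.vandermonde]
    · ring
    · linear_combination -hroot j
  have hpow : A ^ n * V = V * Matrix.diagonal v ^ n := by
    induction n with
    | zero => simp
    | succ k ih => rw [pow_succ, mul_assoc, hAV, ← mul_assoc, ih, mul_assoc, ← pow_succ]
  have hcast : ((recurrenceMatrix ^ n - 1).det : ℂ) = (A ^ n - 1).det := by
    have := (Int.castRingHom ℂ).map_det (recurrenceMatrix ^ n - 1)
    rw [eq_intCast] at this
    rw [this, map_sub, map_pow, map_one]
    rfl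
  have hdetV : V.det ≠ 0 := by
    rw [hV, Matrix.det_transpose]
    exact Matrix.det_vandermonde_ne_zero_iff.2 hv
  have hmul : (A ^ n - 1) * V = V * Matrix.diagonal (fun i => v i ^ n - 1) := by
    have : Matrix.diagonal (fun i => v i ^ n - 1) = Matrix.diagonal v ^ n - 1 := by
      rw [Matrix.diagonal_pow, ← Matrix.diagonal_one, Matrix.diagonal_sub]
      rfl
    rw [this, sub_mul, mul_sub, hpow, one_mul, mul_one]
  have hdet := congrArg Matrix.det hmul
  rw [Matrix.det_mul, Matrix.det_mul, Matrix.det_diagonal, mul_comm] at hdet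
  rw [hcast]
  exact mul_left_cancel₀ hdetV hdet

/-- Bounds for `det (A ^ n - 1)` in terms of the real root `ρ` of `X ^ 3 + X + 1` and the modulus
`r` of its other two roots. -/
theorem exists_abs_det_recurrenceMatrix_bounds :
    ∃ ρ r : ℝ, |ρ| ≤ 7 / 10 ∧ 1 < r ∧ 73 / 50 ≤ r ^ 2 ∧ ∀ n,
      |ρ ^ n - 1| * (r ^ n - 1) ^ 2 ≤ |((recurrenceMatrix ^ n - 1).det : ℝ)| ∧
      |((recurrenceMatrix ^ n - 1).det : ℝ)| ≤ |ρ ^ n - 1| * (r ^ n + 1) ^ 2 := by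
  obtain ⟨ρ, ⟨hρ1, hρ2⟩, hρ⟩ : ∃ ρ ∈ Set.Icc (-7 / 10 : ℝ) (-17 / 25), ρ ^ 3 + ρ + 1 = 0 := by
    refine intermediate_value_Icc (f := fun x : ℝ => x ^ 3 + x + 1) (by norm_num)
      (by fun_prop) ⟨by norm_num, by norm_num⟩
  set w : ℝ := √(3 * ρ ^ 2 + 4) / 2 with hw
  have hw2 : w ^ 2 = (3 * ρ ^ 2 + 4) / 4 := by
    rw [hw, div_pow, Real.sq_sqrt (by positivity)]
    norm_num
  have hw0 : 0 < w := by positivity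
  set α : ℂ := ⟨-ρ / 2, w⟩ with hα
  have hαroot : α ^ 3 + α + 1 = 0 := by
    apply Complex.ext
    · simp [hα, pow_succ]
      linear_combination (3 / 2 * ρ) * hw2 + hρ
    · simp [hα, pow_succ]
      linear_combination -w * hw2
  set r := ‖α‖ with hr
  have hr2 : r ^ 2 = 1 + ρ ^ 2 := by
    rw [hr, Complex.sq_norm, Complex.normSq_apply]
    simp only [hα]
    linear_combination hw2
  have hr1 : 1 < r := by nlinarith [norm_nonneg α]
  have hdet (n : ℕ) :
      |((recurrenceMatrix ^ n - 1).det : ℝ)| = |ρ ^ n - 1| * ‖α ^ n - 1‖ ^ 2 := by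
    have h := det_recurrenceMatrix_pow_sub_one (v := ![(ρ : ℂ), α, starRingEnd ℂ α]) ?_ ?_ n
    · have hconj : ‖starRingEnd ℂ α ^ n - 1‖ = ‖α ^ n - 1‖ := by
        rw [← Complex.norm_conj (α ^ n - 1)]
        simp
      have hreal : ‖(ρ : ℂ) ^ n - 1‖ = |ρ ^ n - 1| := by
        rw [← Real.norm_eq_abs, ← Complex.norm_real]
        simp
      have hnorm := congrArg norm h
      rw [Fin.prod_univ_three, norm_mul, norm_mul, Complex.norm_intCast] at hnorm
      rw [hnorm]
      simp only [Matrix.cons_val]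
      rw [hconj, hreal]
      ring
    · intro i j hij
      fin_cases i <;> fin_cases j <;> simp [hα, Complex.ext_iff] at hij ⊢ <;> linarith
    · intro i
      fin_cases i
      · simpa using mod_cast hρ
      · simpa using hαroot
      · simpa using congrArg (starRingEnd ℂ) hαroot
  refine ⟨ρ, r, abs_le.2 ⟨by linarith, by linarith⟩, hr1, by nlinarith, fun n => ?_⟩
  rw [hdet]
  have hlow : r ^ n - 1 ≤ ‖α ^ n - 1‖ := by
    simpa [hr] using norm_sub_norm_le (α ^ n) 1
  have hup : ‖α ^ n - 1‖ ≤ r ^ n + 1 := by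
    simpa [hr] using norm_sub_le (α ^ n) 1
  have h1 : 1 ≤ r ^ n := one_le_pow₀ hr1.le
  constructor <;> gcongr

theorem cube_lt_pow {h : ℕ} (hh : 80 ≤ h) :
    ((2 * h + 1) * h : ℝ) ^ 3 < 1 / 5 * (73 / 50) ^ h := by
  induction h, hh using Nat.le_induction with
  | base => norm_num
  | succ h hh ih =>
    have hh' : (80 : ℝ) ≤ h := by exact_mod_cast hh
    have hstep : ((2 * (h + 1) + 1) * (h + 1) : ℝ) ≤ 21 / 20 * ((2 * h + 1) * h) := by nlinarith
    calc ((2 * ((h + 1 : ℕ) : ℝ) + 1) * ((h + 1 : ℕ) : ℝ)) ^ 3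
        ≤ (21 / 20 * ((2 * h + 1) * h : ℝ)) ^ 3 := by push_cast; gcongr
      _ = (21 / 20) ^ 3 * ((2 * h + 1) * h : ℝ) ^ 3 := by ring
      _ < (21 / 20) ^ 3 * (1 / 5 * (73 / 50) ^ h) := by gcongr
      _ ≤ 73 / 50 * (1 / 5 * (73 / 50) ^ h) := by gcongr; norm_num
      _ = 1 / 5 * (73 / 50) ^ (h + 1) := by ring

theorem exists_zmod_labelling_of_large {n : ℕ} (hn : 160 ≤ n) :
    ∃ m : ℕ, m ≠ 0 ∧ ∃ x : ZMod n → ZMod m, Function.Injective x ∧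
      ∀ j, x j + x (j + 1) + x (j + 3) = 0 := by
  obtain ⟨ρ, r, hρ, hr1, hr2, hbound⟩ := exists_abs_det_recurrenceMatrix_bounds
  have habs {k : ℕ} (hk : 1 ≤ k) : |ρ ^ k| ≤ 7 / 10 := by
    rw [abs_pow]
    exact (pow_le_of_le_one (abs_nonneg ρ) (by linarith) (by lia)).trans hρ
  have hpos {k : ℕ} (hk : 1 ≤ k) : 0 < |((recurrenceMatrix ^ k - 1).det : ℝ)| := by
    have h1 : 1 < r ^ k := one_lt_pow₀ hr1 (by lia)
    have h2 : ρ ^ k - 1 ≠ 0 := by linarith [(abs_le.1 (habs hk)).2]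
    exact (mul_pos (abs_pos.2 h2) (pow_pos (sub_pos.2 h1) 2)).trans_le (hbound k).1
  have hdet {k : ℕ} (hk : 1 ≤ k) : (recurrenceMatrix ^ k - 1).det ≠ 0 := by
    simpa using hpos hk
  refine ⟨_, Int.natAbs_ne_zero.2 (hdet (k := n) (by lia)),
    exists_injective_of_lt (by lia) rfl fun k hk hkn => ⟨hdet hk, ?_⟩⟩
  rw [← Nat.cast_lt (α := ℝ), Nat.cast_mul, Nat.cast_pow, Nat.cast_mul, Nat.cast_natAbs,
    Nat.cast_natAbs, Int.cast_abs, Int.cast_abs]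
  set h := n / 2 with hh
  set s := r ^ h with hs
  have hs2 : (73 / 50 : ℝ) ^ h ≤ s ^ 2 := by
    rw [hs, ← pow_mul, mul_comm, pow_mul]
    gcongr
  have hrk : r ^ k ≤ s := pow_le_pow_right₀ hr1.le hkn
  have hrn : s ^ 2 ≤ r ^ n := by
    rw [hs, ← pow_mul]
    exact pow_le_pow_right₀ hr1.le (by lia)
  have hcube := cube_lt_pow (h := h) (by lia)
  have hs10 : 10 ≤ s := by
    have : (100 : ℝ) ≤ (73 / 50) ^ h :=
      le_trans (by norm_num) (pow_le_pow_right₀ (by norm_num) (show 80 ≤ h by lia))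
    nlinarith [show 0 < s by positivity]
  have hn2 : (n : ℝ) ≤ 2 * h + 1 := by
    exact_mod_cast (show n ≤ 2 * h + 1 by lia)
  have hρn : 9 / 10 ≤ |ρ ^ n - 1| := by
    have h1 : |ρ ^ n| ≤ (7 / 10) ^ 10 := by
      rw [abs_pow]
      exact (pow_le_pow_of_le_one (abs_nonneg ρ) (by linarith) (by lia)).trans
        (pow_le_pow_left₀ (abs_nonneg ρ) hρ 10)
    rw [abs_sub_comm]
    refine le_trans ?_ (le_abs_self _)
    linarith [le_abs_self (ρ ^ n), show (7 / 10 : ℝ) ^ 10 ≤ 1 / 10 by norm_num]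
  have hρk : |ρ ^ k - 1| ≤ 2 :=
    abs_le.2 ⟨by linarith [(abs_le.1 (habs hk)).1], by linarith [(abs_le.1 (habs hk)).2]⟩
  calc ((n : ℝ) * h) ^ 3 * |((recurrenceMatrix ^ k - 1).det : ℝ)|
      ≤ ((2 * h + 1) * h) ^ 3 * (2 * (s + 1) ^ 2) := by
        gcongr
        refine (hbound k).2.trans ?_
        gcongr
    _ < 1 / 5 * (73 / 50) ^ h * (2 * (s + 1) ^ 2) := by gcongr
    _ ≤ 1 / 5 * s ^ 2 * (2 * (s + 1) ^ 2) := by gcongr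
    _ ≤ 9 / 10 * (s ^ 2 - 1) ^ 2 := by nlinarith [mul_nonneg (sq_nonneg (s + 1)) (sq_nonneg (s - 10))]
    _ ≤ |ρ ^ n - 1| * (r ^ n - 1) ^ 2 := by
        gcongr
        nlinarith
    _ ≤ |((recurrenceMatrix ^ n - 1).det : ℝ)| := (hbound n).1

theorem exists_zmod_labelling_of_root {n m : ℕ} (hn : 0 < n) (hm : m ≠ 0) (l : ZMod m)
    (hroot : l ^ 3 + l + 1 = 0) (hl : l ^ n = 1) (hord : ∀ k < n, 0 < k → l ^ k ≠ 1) :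
    ∃ m : ℕ, m ≠ 0 ∧ ∃ x : ZMod n → ZMod m, Function.Injective x ∧
      ∀ j, x j + x (j + 1) + x (j + 3) = 0 := by
  have : NeZero n := ⟨hn.ne'⟩
  have horder : orderOf l = n := (orderOf_eq_iff hn).2 ⟨hl, hord⟩
  have hval (t : ℕ) : l ^ (t : ZMod n).val = l ^ t := by
    rw [ZMod.val_natCast, ← horder, pow_mod_orderOf]
  refine ⟨m, hm, fun j => l ^ j.val, fun i j hij => ?_, fun j => ?_⟩
  · exact ZMod.val_injective n (pow_injOn_Iio_orderOf (by simp [horder, ZMod.val_lt])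
      (by simp [horder, ZMod.val_lt]) hij)
  · obtain ⟨t, rfl⟩ := ZMod.natCast_zmod_surjective j
    have h1 := hval (t + 1)
    have h3 := hval (t + 3)
    push_cast at h1 h3
    simp only [hval, h1, h3]
    linear_combination l ^ t * hroot

/-- `l` is a root of `X ^ 3 + X + 1` modulo `m` of multiplicative order `n`. -/
def IsRootOfOrder (n m l : ℕ) : Prop :=
  m ≠ 0 ∧ (l ^ 3 + l + 1) % m = 0 ∧ l ^ n % m = 1 % m ∧ ∀ k < n, 0 < k → l ^ k % m ≠ 1 % m

instance (n m l : ℕ) : Decidable (IsRootOfOrder n m l) := by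
  unfold IsRootOfOrder
  infer_instance

theorem IsRootOfOrder.exists_zmod_labelling {n m l : ℕ} (hn : 0 < n) (h : IsRootOfOrder n m l) :
    ∃ m : ℕ, m ≠ 0 ∧ ∃ x : ZMod n → ZMod m, Function.Injective x ∧
      ∀ j, x j + x (j + 1) + x (j + 3) = 0 := by
  have hpow (k : ℕ) : (l : ZMod m) ^ k = 1 ↔ l ^ k % m = 1 % m := by
    rw [← Nat.cast_pow, ← Nat.cast_one, ZMod.natCast_eq_natCast_iff']
  refine exists_zmod_labelling_of_root hn h.1 (l : ZMod m) ?_ ((hpow n).2 h.2.2.1)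
    fun k hk hk0 hl => h.2.2.2 k hk hk0 ((hpow k).1 hl)
  exact_mod_cast (ZMod.natCast_eq_zero_iff _ _).2 (Nat.dvd_of_mod_eq_zero h.2.1)

/-- The entry at index `n - 9` is a pair `(m, l)` such that `l` is a root of `X ^ 3 + X + 1` modulo
`m` of order `n`, except for the dummy entries for `n = 14` and `n = 24`. -/
def rootTable : List (ℕ × ℕ) :=
  [(27, 7), (11, 2), (23, 4), (13, 7), (53, 36), (0, 0), (31, 14), (17, 11), (239, 216),
   (37, 25), (457, 16), (61, 37), (43, 38), (67, 58), (47, 25), (0, 0), (4651, 3978), (131, 51),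
   (81, 61), (29, 26), (21577, 10907), (31, 3), (46811, 13318), (449, 321), (207, 142),
   (613, 226), (26881, 11358), (73, 23), (149, 67), (1483, 724), (79, 11), (241, 47),
   (2135117, 1650854), (379, 124), (173, 136), (4357, 252), (837, 169), (47, 35), (283, 216),
   (153, 79), (197, 133), (1301, 666), (2151, 1411), (20593, 1862), (209520979, 20125211),
   (811, 224), (19567351, 16525916), (617, 20), (229, 167), (65657, 58953), (709, 681),
   (143, 46), (4459734401, 2051096448), (1117, 865), (1161, 898), (204353, 183585), (131, 5),
   (67, 13), (13267, 9395), (442069, 256885), (423, 25), (7351, 3929),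
   (203878759789, 112633599223), (1297, 397), (293, 256), (1385429, 675378), (151, 121),
   (2033989, 1105489), (617, 170), (1179, 313), (517609, 436687), (187, 79), (243, 223),
   (83, 35), (20019533360297, 2085399523672), (261, 142), (179916121591, 50541620165),
   (431, 47), (523, 114), (89, 14), (179, 149), (297, 277), (1004948196253, 738933342073),
   (277, 37), (421299, 13318), (941, 513), (571, 521), (4041, 3913), (971, 223), (491, 394),
   (621, 142), (79361, 74823), (607, 26), (5517, 3904), (2227273, 89304), (937, 572),
   (1333, 1285), (628616783, 291285745), (621671, 560143), (1053, 709), (5233, 3842), (121, 57),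
   (1341, 961), (493, 113), (227, 203), (5701, 4285), (461, 236), (349, 247), (937, 705),
   (6229009489, 4140999560), (1429, 803), (2169, 529), (1102553, 290556), (9883, 8188),
   (2707, 2589), (19607722333, 5178295092), (251, 89), (127, 86),
   (403421507258034801533, 90187350026420313574), (42116007041, 34545572470), (1557, 655),
   (583, 354), (263, 81), (299, 280), (61505053, 4438817), (269, 203), (271, 122), (137, 66),
   (823, 209), (423, 223), (6673, 5613), (319, 200), (283, 101), (2273, 1447), (1219, 142),
   (459, 385), (4931, 17), (137387, 48075), (1773, 133), (149, 93), (1789, 141), (1661, 574),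
   (3889783269589466035463903, 714728499244819141438399), (71593, 28163), (6453, 1411),
   (41339, 36573), (62498791, 7957453), (169, 72), (1977526157, 56490028), (2581721, 2007990),
   (161934823, 96599036)]

theorem isRootOfOrder_rootTable : ∀ i < 151, i ≠ 5 → i ≠ 15 →
    IsRootOfOrder (i + 9) (rootTable.getD i (0, 0)).1 (rootTable.getD i (0, 0)).2 := by
  decide +kernel

theorem exists_zmod_labelling {n : ℕ} (hn : 9 ≤ n) (h14 : n ≠ 14) (h24 : n ≠ 24) :
    ∃ m : ℕ, m ≠ 0 ∧ ∃ x : ZMod n → ZMod m, Function.Injective x ∧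
      ∀ j, x j + x (j + 1) + x (j + 3) = 0 := by
  rcases le_or_gt 160 n with h | h
  · exact exists_zmod_labelling_of_large h
  · have hroot := isRootOfOrder_rootTable (n - 9) (by lia) (by lia) (by lia)
    rw [Nat.sub_add_cancel hn] at hroot
    exact hroot.exists_zmod_labelling (by lia)

theorem exists_realization_of_int_tripleDet {n : ℕ} (hn : 9 ≤ n) (p : ZMod n → Fin 3 → ℤ)
    (hp : ∀ j, p j 2 ≠ 0)
    (hdet : ∀ j k, tripleDet (p j) (p (j + 1)) (p k) = 0 ↔ k = j ∨ k = j + 1 ∨ k = j + 3) :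
    ∃ P : ZMod n → EuclideanSpace ℝ (Fin 2),
      Function.Injective P ∧
      (∀ j : ZMod n, Collinear ℝ ({P j, P (j + 1), P (j + 3)} : Set (EuclideanSpace ℝ (Fin 2)))) ∧
      (∀ j k : ZMod n, k ∉ ({j, j + 1, j + 3} : Set (ZMod n)) →
        ¬ Collinear ℝ
          ({P j, P (j + 1), P (j + 3), P k} : Set (EuclideanSpace ℝ (Fin 2)))) := by
  refine exists_realization_of_tripleDet hn (fun j i => p j i) (fun j => by simpa using hp j)
    fun j k => ?_
  rw [← hdet]
  simp only [tripleDet]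
  norm_cast

/-- Homogeneous coordinates of a realization of `𝒞(14,1,3)`. -/
def coordinates14 : ZMod 14 → Fin 3 → ℤ :=
  (![![-2, 3, 1], ![1, -1, 1], ![3, -2, 1], ![-1, 2, 2], ![1, 0, -1], ![2, 0, 3], ![-2, -2, 1],
    ![1, 0, 2], ![-2, -1, -1], ![-3, -2, -1], ![4, 3, -1], ![-1, -2, 1], ![-6, -5, 5],
    ![2, -1, 1]] :
    Fin 14 → Fin 3 → ℤ)

/-- Homogeneous coordinates of a realization of `𝒞(24,1,3)`. -/
def coordinates24 : ZMod 24 → Fin 3 → ℤ :=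
  (![![1, 0, 1], ![2, -3, 2], ![3, 2, 1], ![-3, 2, -3], ![-7, 4, -5], ![3, 0, 2], ![-1, 2, -5],
    ![-4, 4, -3], ![-2, -2, 3], ![-5, 2, 9], ![-5, 7, -6], ![-1, 6, 3], ![-5, 8, -9],
    ![3, 5, 12], ![-8, 15, -12], ![7, -21, 6], ![-5, 3, -12], ![-4, -3, -12], ![1, 5, 6],
    ![-3, 0, -8], ![-5, 9, -6], ![9, -15, 14], ![-31, 45, -46], ![11, -15, 26]] :
    Fin 24 → Fin 3 → ℤ)


/-- For every `n ≥ 9` the combinatorial configuration `𝒞(n,1,3)` has a geometric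
realization in the Euclidean plane: there are distinct points `P j` (`j ∈ ZMod n`) such that
`P j, P (j+1), P (j+3)` are collinear for every `j`, and no further point of the configuration
lies on any of these lines. Hence geometric `(n₃)` configurations exist for all `n ≥ 9`. -/
theorem geometric_n3_configurations_exist (n : ℕ) (hn : 9 ≤ n) :
    ∃ P : ZMod n → EuclideanSpace ℝ (Fin 2),
      Function.Injective P ∧
      (∀ j : ZMod n, Collinear ℝ ({P j, P (j + 1), P (j + 3)} : Set (EuclideanSpace ℝ (Fin 2)))) ∧
      (∀ j k : ZMod n, k ∉ ({j, j + 1, j + 3} : Set (ZMod n)) →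
        ¬ Collinear ℝ ({P j, P (j + 1), P (j + 3), P k} : Set (EuclideanSpace ℝ (Fin 2)))) := by
  by_cases h14 : n = 14
  · subst h14
    exact exists_realization_of_int_tripleDet hn coordinates14 (by decide +kernel)
      (by decide +kernel)
  by_cases h24 : n = 24
  · subst h24
    exact exists_realization_of_int_tripleDet hn coordinates24 (by decide +kernel)
      (by decide +kernel)
  obtain ⟨m, hm, x, hx, hsum⟩ := exists_zmod_labelling hn h14 h24
  have : NeZero m := ⟨hm⟩
  refine exists_realization_of_unitAddCircle hn (fun j => ZMod.toAddCircle (x j))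
    ((ZMod.toAddCircle_injective m).comp hx) fun j => ?_
  rw [← map_add, ← map_add, hsum, map_zero]
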